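/- arXiv:1206.2161 — 4 statements merged into one kernel-verified Lean document; each statement's English description precedes it below -/
import Mathlib

section
/- Let k ∈ ℝ, x, y ∈ ℝ³ with x ≠ y, τ ∈ ℝ³, and λ : ℝ³ → ℝ any function. Then the ℂ-valued function s ↦ g_k(F_s(x) − F_s(y)) = g_k((x − y) + s·(λ(x) − λ(y))·τ) is differentiable at s = 0, and its derivative there equals g_k(x − y) · (i·k − 1/‖x − y‖) · ⟪x − y, τ⟫ · (λ(x) − λ(y)) / ‖x − y‖. -/
/-- The fundamental solution of the Helmholtz equation,
`g_k(z) = exp(i k ‖z‖) / (4π ‖z‖)`. -/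
noncomputable def helmholtzKernel (k : ℝ) (z : EuclideanSpace ℝ (Fin 3)) : ℂ :=
  Complex.exp (Complex.I * k * ‖z‖) / (4 * Real.pi * ‖z‖)

/-- For `x ≠ y`, the map
`s ↦ g_k(F_s(x) − F_s(y)) = g_k((x − y) + s·(λ x − λ y)·τ)` is differentiable at `s = 0`
with derivative `g_k(x − y)·(i k − 1/‖x − y‖)·⟪x − y, τ⟫·(λ x − λ y)/‖x − y‖`. -/
theorem shape_deriv_of_helmholtzKernel
    (k : ℝ) (x y : EuclideanSpace ℝ (Fin 3)) (hxy : x ≠ y)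
    (τ : EuclideanSpace ℝ (Fin 3)) (lam : EuclideanSpace ℝ (Fin 3) → ℝ) :
    HasDerivAt (fun s : ℝ => helmholtzKernel k ((x - y) + s • ((lam x - lam y) • τ)))
      (helmholtzKernel k (x - y) * (Complex.I * k - 1 / (‖x - y‖ : ℂ))
        * (((inner ℝ (x - y) τ : ℝ) : ℂ) * ((lam x - lam y : ℝ) : ℂ) / (‖x - y‖ : ℂ))) 0 := by
  have hv : x - y ≠ 0 := sub_ne_zero.mpr hxy
  have hn : ‖x - y‖ ≠ 0 := norm_ne_zero_iff.mpr hv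
  have h1 : HasDerivAt (fun s : ℝ => (x - y) + s • ((lam x - lam y) • τ))
      ((lam x - lam y) • τ) 0 := by
    simpa using ((hasDerivAt_id (0 : ℝ)).smul_const ((lam x - lam y) • τ)).const_add (x - y)
  have h2 : HasDerivAt (fun s : ℝ => ‖(x - y) + s • ((lam x - lam y) • τ)‖)
      (inner ℝ (x - y) τ * (lam x - lam y) / ‖x - y‖) 0 := by
    have h := h1.norm_sq.sqrt (by simpa using hv)
    simp only [Real.sqrt_sq (norm_nonneg _), zero_smul, add_zero, inner_smul_right] at h
    convert h using 1
    field_simp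
  have h3 := h2.ofReal_comp
  have hnc : (‖x - y‖ : ℂ) ≠ 0 := by exact_mod_cast hn
  have hpi : (Real.pi : ℂ) ≠ 0 := by exact_mod_cast Real.pi_ne_zero
  have h4 := ((h3.const_mul (Complex.I * k)).cexp).div (h3.const_mul (4 * Real.pi : ℂ))
    (by simp only [zero_smul, add_zero]; exact mul_ne_zero (mul_ne_zero (by norm_num) hpi) hnc)
  unfold helmholtzKernel
  refine h4.congr_deriv ?_
  simp only [zero_smul, add_zero]
  push_cast
  field_simp
end

section
/- Let k ∈ ℝ, x, y ∈ ℝ³ with x ≠ y, τ, u, v, gx, gy ∈ ℝ³, a, b ∈ ℝ. Define for s ∈ ℝ the deformed points x_s = x + s·a·τ, y_s = y + s·b·τ and the matrices G_s(x) = I + s·τ ⊗ gx, G_s(y) = I + s·τ ⊗ gy. Then the ℂ-valued function s ↦ ⟪G_s(x)·v, G_s(y)·u⟫ · g_k(x_s − y_s) is differentiable at s = 0, and its derivative there equals [⟪gx, v⟫·⟪τ, u⟫ + ⟪τ, v⟫·⟪gy, u⟫] · g_k(x − y) + ⟪v, u⟫ · g_k(x − y) · (i·k − 1/‖x − y‖)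 · ⟪x − y, τ⟫ · (a − b) / ‖x − y‖. -/
/-- With `x_s = x + s·a·τ`, `y_s = y + s·b·τ`, `G_s(x)v = v + s·⟪gx,v⟫·τ`
and `G_s(y)u = u + s·⟪gy,u⟫·τ`, the map `s ↦ ⟪G_s(x)v, G_s(y)u⟫ · g_k(x_s − y_s)`
is differentiable at `s = 0` with derivative
`[⟪gx,v⟫⟪τ,u⟫ + ⟪τ,v⟫⟪gy,u⟫]·g_k(x−y) + ⟪v,u⟫·g_k(x−y)·(ik − 1/‖x−y‖)·⟪x−y,τ⟫·(a−b)/‖x−y‖`. -/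
theorem shape_deriv_of_vector_potential_integrand
    (k : ℝ) (x y : EuclideanSpace ℝ (Fin 3)) (hxy : x ≠ y)
    (τ u v gx gy : EuclideanSpace ℝ (Fin 3)) (a b : ℝ) :
    HasDerivAt
      (fun s : ℝ =>
        ((inner ℝ (v + s • ((inner ℝ gx v : ℝ) • τ)) (u + s • ((inner ℝ gy u : ℝ) • τ)) : ℝ) : ℂ)
          * helmholtzKernel k ((x + (s * a) • τ) - (y + (s * b) • τ)))
      ((((inner ℝ gx v : ℝ) * (inner ℝ τ u : ℝ) + (inner ℝ τ v : ℝ) * (inner ℝ gy u : ℝ) : ℝ) : ℂ)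
          * helmholtzKernel k (x - y)
        + ((inner ℝ v u : ℝ) : ℂ) * helmholtzKernel k (x - y)
            * (Complex.I * k - 1 / (‖x - y‖ : ℂ))
            * (((inner ℝ (x - y) τ : ℝ) : ℂ) * ((a - b : ℝ) : ℂ) / (‖x - y‖ : ℂ))) 0 := by
  have hz : x - y ≠ 0 := sub_ne_zero.mpr hxy
  have hn : ‖x - y‖ ≠ 0 := norm_ne_zero_iff.mpr hz
  have hw : HasDerivAt (fun s : ℝ => (x + (s * a) • τ) - (y + (s * b) • τ)) ((a - b) • τ) 0 := by
    have h1 : HasDerivAt (fun s : ℝ => (s * a) • τ) (((1 : ℝ) * a) • τ) 0 :=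
      ((hasDerivAt_id (0 : ℝ)).mul_const a).smul_const τ
    have h2 : HasDerivAt (fun s : ℝ => (s * b) • τ) (((1 : ℝ) * b) • τ) 0 :=
      ((hasDerivAt_id (0 : ℝ)).mul_const b).smul_const τ
    have h3 := (h1.const_add x).sub (h2.const_add y)
    rw [one_mul, one_mul, ← sub_smul] at h3
    exact h3
  have hr : HasDerivAt (fun s : ℝ => ‖(x + (s * a) • τ) - (y + (s * b) • τ)‖)
      ((inner ℝ (x - y) τ : ℝ) * (a - b) / ‖x - y‖) 0 := by
    have h1 := hw.norm_sq.sqrt (by simpa using hn)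
    simp only [Real.sqrt_sq (norm_nonneg _)] at h1
    refine h1.congr_deriv ?_
    simp only [zero_mul, zero_smul, add_zero, inner_smul_right]
    field_simp
  have hrc := hr.ofReal_comp
  have hnc : (‖x - y‖ : ℂ) ≠ 0 := by exact_mod_cast hn
  have hpi : (Real.pi : ℂ) ≠ 0 := by exact_mod_cast Real.pi_ne_zero
  have hg : HasDerivAt
      (fun s : ℝ => helmholtzKernel k ((x + (s * a) • τ) - (y + (s * b) • τ)))
      (helmholtzKernel k (x - y) * (Complex.I * k - 1 / (‖x - y‖ : ℂ))
        * (((inner ℝ (x - y) τ : ℝ) : ℂ) * ((a - b : ℝ) : ℂ) / (‖x - y‖ : ℂ))) 0 := by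
    have h1 := (hrc.const_mul (Complex.I * k)).cexp.div (hrc.const_mul (4 * (Real.pi : ℂ)))
      (by simpa using hz)
    refine h1.congr_deriv ?_
    simp only [helmholtzKernel, zero_mul, zero_smul, add_zero]
    push_cast
    field_simp
  have hv : HasDerivAt (fun s : ℝ => v + s • ((inner ℝ gx v : ℝ) • τ))
      ((inner ℝ gx v : ℝ) • τ) 0 := by
    simpa using ((hasDerivAt_id (0 : ℝ)).smul_const ((inner ℝ gx v : ℝ) • τ)).const_add v
  have hu : HasDerivAt (fun s : ℝ => u + s • ((inner ℝ gy u : ℝ) • τ))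
      ((inner ℝ gy u : ℝ) • τ) 0 := by
    simpa using ((hasDerivAt_id (0 : ℝ)).smul_const ((inner ℝ gy u : ℝ) • τ)).const_add u
  have hi := (hv.inner ℝ hu).ofReal_comp
  refine (hi.mul hg).congr_deriv ?_
  simp only [zero_mul, zero_smul, add_zero, inner_smul_right, inner_smul_left,
    real_inner_comm τ v]
  push_cast
  simp
  ring
end

section
/- Let k ∈ ℝ, τ ∈ ℝ³, and let T_p, T_q ⊆ ℝ³ be compact, disjoint sets each of finite two-dimensional Hausdorff measure μH². Let φ, ψ : ℝ³ → ℝ and λ : ℝ³ → ℝ be continuous. Then the function I₂ : s ↦ ∫_{T_q} ∫_{T_p} φ(x)·ψ(y)·g_k(F_s(x) − F_s(y)) dμH²(y) dμH²(x) is differentiable at s = 0, and (d/ds) I₂|_{s=0} = ∫_{T_q} ∫_{T_p} φ(x)·ψ(y)·g_k(x − y)·(i·k − 1/‖x − y‖)·⟪x − y, τ⟫·(λ(x) − λ(y))/‖x − y‖ dμH²(y) dμH²(x). -/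
open MeasureTheory
open scoped MeasureTheory

/-- Differentiation under a double integral over compact sets of finite measure. -/
theorem hasDerivAt_double_integral_aux {E : Type*} [NormedAddCommGroup E]
    [MeasurableSpace E] [BorelSpace E] [SecondCountableTopology E] (μ : Measure E) (Tp Tq : Set E)
    (hTp : IsCompact Tp) (hTq : IsCompact Tq) (hTpm : μ Tp < ⊤) (hTqm : μ Tq < ⊤)
    (F F' : ℝ → E → E → ℂ) (ε : ℝ) (hε : 0 < ε)
    (hF : ContinuousOn (fun p : ℝ × E × E => F p.1 p.2.1 p.2.2)
      (Metric.closedBall (0 : ℝ) ε ×ˢ (Tq ×ˢ Tp)))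
    (hF' : ContinuousOn (fun p : ℝ × E × E => F' p.1 p.2.1 p.2.2)
      (Metric.closedBall (0 : ℝ) ε ×ˢ (Tq ×ˢ Tp)))
    (hd : ∀ s ∈ Metric.closedBall (0 : ℝ) ε, ∀ x ∈ Tq, ∀ y ∈ Tp,
      HasDerivAt (fun s => F s x y) (F' s x y) s) :
    HasDerivAt (fun s : ℝ => ∫ x in Tq, ∫ y in Tp, F s x y ∂μ ∂μ)
      (∫ x in Tq, ∫ y in Tp, F' 0 x y ∂μ ∂μ) 0 := by
  have hK : IsCompact (Metric.closedBall (0 : ℝ) ε ×ˢ (Tq ×ˢ Tp)) :=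
    (isCompact_closedBall _ _).prod (hTq.prod hTp)
  have mp : MeasurableSet Tp := hTp.isClosed.measurableSet
  have mq : MeasurableSet Tq := hTq.isClosed.measurableSet
  haveI : IsFiniteMeasure (μ.restrict Tp) := ⟨by simpa using hTpm⟩
  haveI : IsFiniteMeasure (μ.restrict Tq) := ⟨by simpa using hTqm⟩
  obtain ⟨C, hC⟩ := hK.exists_bound_of_continuousOn hF
  obtain ⟨C', hC'⟩ := hK.exists_bound_of_continuousOn hF'
  have sub : Metric.ball (0 : ℝ) ε ⊆ Metric.closedBall 0 ε := Metric.ball_subset_closedBall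
  have h0 : (0 : ℝ) ∈ Metric.ball (0 : ℝ) ε := Metric.mem_ball_self hε
  -- inner measurability
  have im : ∀ (G : ℝ → E → E → ℂ), ContinuousOn (fun p : ℝ × E × E => G p.1 p.2.1 p.2.2)
      (Metric.closedBall (0 : ℝ) ε ×ˢ (Tq ×ˢ Tp)) → ∀ s ∈ Metric.closedBall (0 : ℝ) ε,
      ∀ x ∈ Tq, AEStronglyMeasurable (fun y => G s x y) (μ.restrict Tp) := by
    intro G hG s hs x hx
    refine ContinuousOn.aestronglyMeasurable ?_ mp
    exact hG.comp (f := fun y => (s, x, y)) (by fun_prop) (fun y hy => ⟨hs, hx, hy⟩)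
  -- outer measurability
  have om : ∀ (G : ℝ → E → E → ℂ) (B : ℝ),
      ContinuousOn (fun p : ℝ × E × E => G p.1 p.2.1 p.2.2)
      (Metric.closedBall (0 : ℝ) ε ×ˢ (Tq ×ˢ Tp)) →
      (∀ p ∈ Metric.closedBall (0 : ℝ) ε ×ˢ (Tq ×ˢ Tp), ‖G p.1 p.2.1 p.2.2‖ ≤ B) →
      ∀ s ∈ Metric.closedBall (0 : ℝ) ε,
      AEStronglyMeasurable (fun x => ∫ y in Tp, G s x y ∂μ) (μ.restrict Tq) := by
    intro G B hG hB s hs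
    refine ContinuousOn.aestronglyMeasurable ?_ mq
    refine continuousOn_of_dominated (bound := fun _ => B) (fun x hx => im G hG s hs x hx) ?_
      (integrable_const B) ?_
    · intro x hx
      exact (ae_restrict_iff' mp).2 (.of_forall fun y hy => hB (s, x, y) ⟨hs, hx, hy⟩)
    · refine (ae_restrict_iff' mp).2 (.of_forall fun y hy => ?_)
      exact hG.comp (f := fun x => (s, x, y)) (by fun_prop) (fun x hx => ⟨hs, hx, hy⟩)
  have ob : ∀ (G : ℝ → E → E → ℂ) (B : ℝ),
      (∀ p ∈ Metric.closedBall (0 : ℝ) ε ×ˢ (Tq ×ˢ Tp), ‖G p.1 p.2.1 p.2.2‖ ≤ B) →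
      ∀ s ∈ Metric.closedBall (0 : ℝ) ε, ∀ x ∈ Tq,
      ‖∫ y in Tp, G s x y ∂μ‖ ≤ B * μ.real Tp := by
    intro G B hB s hs x hx
    exact norm_setIntegral_le_of_norm_le_const hTpm (fun y hy => hB (s, x, y) ⟨hs, hx, hy⟩)
  refine (hasDerivAt_integral_of_dominated_loc_of_deriv_le (μ := μ.restrict Tq)
    (F := fun s x => ∫ y in Tp, F s x y ∂μ) (F' := fun s x => ∫ y in Tp, F' s x y ∂μ)
    (bound := fun _ => C' * μ.real Tp) (Metric.ball_mem_nhds 0 hε) ?_ ?_ ?_ ?_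
    (integrable_const _) ?_).2
  · filter_upwards [Metric.ball_mem_nhds 0 hε] with s hs
    exact om F C hF hC s (sub hs)
  · refine Integrable.of_bound (om F C hF hC 0 (sub h0)) (C * μ.real Tp) ?_
    exact (ae_restrict_iff' mq).2 (.of_forall fun x hx => ob F C hC 0 (sub h0) x hx)
  · exact om F' C' hF' hC' 0 (sub h0)
  · exact (ae_restrict_iff' mq).2 (.of_forall fun x hx s hs => ob F' C' hC' s (sub hs) x hx)
  · refine (ae_restrict_iff' mq).2 (.of_forall fun x hx s hs => ?_)
    refine (hasDerivAt_integral_of_dominated_loc_of_deriv_le (μ := μ.restrict Tp)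
      (F := fun s y => F s x y) (F' := fun s y => F' s x y)
      (bound := fun _ => C') (Metric.isOpen_ball.mem_nhds hs) ?_ ?_ ?_ ?_
      (integrable_const _) ?_).2
    · filter_upwards [Metric.isOpen_ball.mem_nhds hs] with t ht
      exact im F hF t (sub ht) x hx
    · refine Integrable.of_bound (im F hF s (sub hs) x hx) C ?_
      exact (ae_restrict_iff' mp).2 (.of_forall fun y hy => hC (s, x, y) ⟨sub hs, hx, hy⟩)
    · exact im F' hF' s (sub hs) x hx
    · exact (ae_restrict_iff' mp).2
        (.of_forall fun y hy t ht => hC' (t, x, y) ⟨sub ht, hx, hy⟩)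
    · exact (ae_restrict_iff' mp).2 (.of_forall fun y hy t ht => hd t (sub ht) x hx y hy)

theorem helmholtzKernel_line_hasDerivAt (k : ℝ) (τ : EuclideanSpace ℝ (Fin 3))
    (x y : EuclideanSpace ℝ (Fin 3)) (a b s : ℝ)
    (hz : (x + (s * a) • τ) - (y + (s * b) • τ) ≠ 0) :
    HasDerivAt (fun s : ℝ => helmholtzKernel k ((x + (s * a) • τ) - (y + (s * b) • τ)))
      (helmholtzKernel k ((x + (s * a) • τ) - (y + (s * b) • τ))
        * (Complex.I * k - 1 / (‖(x + (s * a) • τ) - (y + (s * b) • τ)‖ : ℂ))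
        * (((inner ℝ ((x + (s * a) • τ) - (y + (s * b) • τ)) τ : ℝ) : ℂ) * ((a - b : ℝ) : ℂ)
          / (‖(x + (s * a) • τ) - (y + (s * b) • τ)‖ : ℂ))) s := by
  have hlin : HasDerivAt (fun s : ℝ => (x + (s * a) • τ) - (y + (s * b) • τ))
      ((a - b) • τ) s := by
    have h1 := (((hasDerivAt_id s).mul_const a).smul_const τ).const_add x
    have h2 := (((hasDerivAt_id s).mul_const b).smul_const τ).const_add y
    have := h1.sub h2
    simp only [id, one_mul, ← sub_smul] at this
    exact this
  have hnorm : HasDerivAt (fun s : ℝ => ‖(x + (s * a) • τ) - (y + (s * b) • τ)‖)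
      (inner ℝ ((x + (s * a) • τ) - (y + (s * b) • τ)) τ * (a - b)
        / ‖(x + (s * a) • τ) - (y + (s * b) • τ)‖) s := by
    have h := hlin.norm_sq.sqrt (by simpa using hz)
    simp only [Real.sqrt_sq (norm_nonneg _)] at h
    convert h using 1
    rw [inner_smul_right]
    have : ‖(x + (s * a) • τ) - (y + (s * b) • τ)‖ ≠ 0 := by simpa using hz
    field_simp
  have hr : ((‖(x + (s * a) • τ) - (y + (s * b) • τ)‖ : ℝ) : ℂ) ≠ 0 := by
    simpa using hz
  have hpi : (Real.pi : ℂ) ≠ 0 := by exact_mod_cast Real.pi_ne_zero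
  have hc := hnorm.ofReal_comp
  have he := (hc.const_mul (Complex.I * k)).cexp
  have hq := he.div (hc.const_mul (4 * Real.pi : ℂ)) (mul_ne_zero (mul_ne_zero (by norm_num) hpi) hr)
  unfold helmholtzKernel
  refine hq.congr_deriv ?_
  push_cast
  generalize ((‖(x + (s * a) • τ) - (y + (s * b) • τ)‖ : ℝ) : ℂ) = r at hr ⊢
  field_simp

/-- shape derivative of the scalar-potential (charge) term of the EFIE
(formula (diffcharge) of the paper): for disjoint compact sets `T_p, T_q` of finite
two-dimensional Hausdorff measure and continuous `φ, ψ, λ`, the map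
`s ↦ ∫_{T_q} ∫_{T_p} φ(x) ψ(y) g_k(F_s(x) − F_s(y))` (with `F_s(x) = x + s·λ(x)·τ`)
is differentiable at `s = 0`, with the stated derivative. -/
theorem shape_deriv_of_charge_integral
    (k : ℝ) (τ : EuclideanSpace ℝ (Fin 3)) (Tp Tq : Set (EuclideanSpace ℝ (Fin 3)))
    (hTp : IsCompact Tp) (hTq : IsCompact Tq) (hdisj : Disjoint Tp Tq)
    (hTpm : μH[2] Tp < ⊤) (hTqm : μH[2] Tq < ⊤)
    (φ ψ lam : EuclideanSpace ℝ (Fin 3) → ℝ)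
    (hφ : Continuous φ) (hψ : Continuous ψ) (hlam : Continuous lam) :
    HasDerivAt
      (fun s : ℝ => ∫ x in Tq, ∫ y in Tp,
        ((φ x * ψ y : ℝ) : ℂ)
          * helmholtzKernel k ((x + (s * lam x) • τ) - (y + (s * lam y) • τ)) ∂μH[2] ∂μH[2])
      (∫ x in Tq, ∫ y in Tp,
        ((φ x * ψ y : ℝ) : ℂ)
          * (helmholtzKernel k (x - y) * (Complex.I * k - 1 / (‖x - y‖ : ℂ))
            * (((inner ℝ (x - y) τ : ℝ) : ℂ) * ((lam x - lam y : ℝ) : ℂ) / (‖x - y‖ : ℂ)))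
        ∂μH[2] ∂μH[2]) 0 := by
  have hzc : Continuous (fun p : ℝ × EuclideanSpace ℝ (Fin 3) × EuclideanSpace ℝ (Fin 3) =>
      (p.2.1 + (p.1 * lam p.2.1) • τ) - (p.2.2 + (p.1 * lam p.2.2) • τ)) := by fun_prop
  obtain ⟨u, v, hu, -, hu0, hv, huv⟩ := generalized_tube_lemma (isCompact_singleton (x := (0 : ℝ)))
    (hTq.prod hTp) (hzc.isOpen_preimage _ (isOpen_compl_singleton (x := 0))) (by
      rintro ⟨s, x, y⟩ ⟨hs, hx, hy⟩
      obtain rfl : s = 0 := hs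
      have : x ≠ y := fun h => Set.disjoint_left.1 hdisj hy (h ▸ hx)
      simpa [sub_eq_zero] using this)
  obtain ⟨ε, hε, hεu⟩ := Metric.nhds_basis_closedBall.mem_iff.1
    (hu.mem_nhds (hu0 (Set.mem_singleton 0)))
  have hne : ∀ p ∈ Metric.closedBall (0 : ℝ) ε ×ˢ (Tq ×ˢ Tp),
      (p.2.1 + (p.1 * lam p.2.1) • τ) - (p.2.2 + (p.1 * lam p.2.2) • τ) ≠ 0 :=
    fun p hp => huv ⟨hεu hp.1, hv hp.2⟩
  have hnc : ∀ p ∈ Metric.closedBall (0 : ℝ) ε ×ˢ (Tq ×ˢ Tp),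
      ((‖(p.2.1 + (p.1 * lam p.2.1) • τ) - (p.2.2 + (p.1 * lam p.2.2) • τ)‖ : ℝ) : ℂ) ≠ 0 :=
    fun p hp => by simpa using hne p hp
  have hpi : (Real.pi : ℂ) ≠ 0 := by exact_mod_cast Real.pi_ne_zero
  have hker : ContinuousOn
      (fun p : ℝ × EuclideanSpace ℝ (Fin 3) × EuclideanSpace ℝ (Fin 3) => helmholtzKernel k
        ((p.2.1 + (p.1 * lam p.2.1) • τ) - (p.2.2 + (p.1 * lam p.2.2) • τ)))
      (Metric.closedBall (0 : ℝ) ε ×ˢ (Tq ×ˢ Tp)) := by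
    unfold helmholtzKernel
    refine ContinuousOn.div (by fun_prop) (by fun_prop) fun p hp => ?_
    exact mul_ne_zero (mul_ne_zero (by norm_num) hpi) (hnc p hp)
  have main := hasDerivAt_double_integral_aux μH[2] Tp Tq hTp hTq hTpm hTqm
    (fun s x y => ((φ x * ψ y : ℝ) : ℂ)
          * helmholtzKernel k ((x + (s * lam x) • τ) - (y + (s * lam y) • τ)))
    (fun s x y => ((φ x * ψ y : ℝ) : ℂ)
      * (helmholtzKernel k ((x + (s * lam x) • τ) - (y + (s * lam y) • τ))
        * (Complex.I * k - 1 / (‖(x + (s * lam x) • τ) - (y + (s * lam y) • τ)‖ : ℂ))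
        * (((inner ℝ ((x + (s * lam x) • τ) - (y + (s * lam y) • τ)) τ : ℝ) : ℂ)
          * ((lam x - lam y : ℝ) : ℂ)
          / (‖(x + (s * lam x) • τ) - (y + (s * lam y) • τ)‖ : ℂ)))) ε hε
    (ContinuousOn.mul (by fun_prop) hker)
    (by
      refine ContinuousOn.mul (by fun_prop) ((hker.mul ?_).mul ?_)
      · exact continuousOn_const.sub (continuousOn_const.div (by fun_prop) hnc)
      · exact ContinuousOn.div (by fun_prop) (by fun_prop) hnc)
    (fun s hs x hx y hy =>
      (helmholtzKernel_line_hasDerivAt k τ x y (lam x) (lam y) s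
        (hne (s, x, y) ⟨hs, hx, hy⟩)).const_mul _)
  simpa only [zero_mul, zero_smul, add_zero] using main
end

section
/- Let k ∈ ℝ, τ ∈ ℝ³, and let T_p, T_q ⊆ ℝ³ be compact, disjoint sets each of finite two-dimensional Hausdorff measure μH². Let u, v : ℝ³ → ℝ³ be continuous, λ : ℝ³ → ℝ continuous, and g : ℝ³ → ℝ³ continuous (playing the role of the gradient ∇λ). Then the function I₁ : s ↦ ∫_{T_q} ∫_{T_p} ⟪(I + s·τ ⊗ g(x))·v(x), (I + s·τ ⊗ g(y))·u(y)⟫ · g_k(F_s(x) − F_s(y)) dμH²(y) dμH²(x) is differentiable at s = 0, and (d/ds) I₁|_{s=0} = ∫_{T_q} ∫_{T_p} { [⟪g(x), v(x)⟫·⟪τ, u(y)⟫ + ⟪τ, v(x)⟫·⟪g(y), u(y)⟫] · g_k(x − y) + ⟪v(x), u(y)⟫ · g_k(x − y)·(i·k − 1/‖x − y‖)·⟪x − y, τ⟫·(λ(x) − λ(y))/‖x − y‖ } dμH²(y) dμH²(x). -/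
open MeasureTheory
open scoped MeasureTheory

open Filter Topology Set

theorem aux_param {X : Type*} [TopologicalSpace X] [MeasurableSpace X] [OpensMeasurableSpace X]
    [TopologicalSpace.PseudoMetrizableSpace X] {K : Set X}
    (hK : IsCompact K) (hKm : MeasurableSet K) (ν : Measure X) [IsFiniteMeasure ν]
    (F F' : ℝ → X → ℂ) (W : Set (ℝ × X)) (hW : IsOpen W) (hKW : ∀ p ∈ K, ((0 : ℝ), p) ∈ W)
    (hF : ContinuousOn (fun q : ℝ × X => F q.1 q.2) W)
    (hF' : ContinuousOn (fun q : ℝ × X => F' q.1 q.2) W)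
    (hd : ∀ s p, (s, p) ∈ W → HasDerivAt (fun t => F t p) (F' s p) s) :
    (∀ᶠ s in 𝓝 (0 : ℝ), IntegrableOn (F s) K ν) ∧ IntegrableOn (F' 0) K ν ∧
      HasDerivAt (fun s => ∫ p in K, F s p ∂ν) (∫ p in K, F' 0 p ∂ν) 0 := by
  have h0 : ({(0 : ℝ)} : Set ℝ) ×ˢ K ⊆ W := by
    rintro ⟨s, p⟩ ⟨hs, hp⟩
    simp only [mem_singleton_iff] at hs
    subst hs
    exact hKW p hp
  obtain ⟨U, V, hU, hV, hUs, hVs, hUV⟩ := generalized_tube_lemma isCompact_singleton hK hW h0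
  have hU0 : U ∈ 𝓝 (0 : ℝ) := hU.mem_nhds (hUs rfl)
  obtain ⟨ε, hε, hεU⟩ := Metric.nhds_basis_closedBall.mem_iff.1 hU0
  have hsub : Metric.closedBall (0 : ℝ) ε ×ˢ K ⊆ W :=
    (prod_mono hεU hVs).trans hUV
  have hb : Metric.closedBall (0 : ℝ) ε ∈ 𝓝 (0 : ℝ) := Metric.closedBall_mem_nhds _ hε
  obtain ⟨C, hC⟩ := ((isCompact_closedBall (0 : ℝ) ε).prod hK).exists_bound_of_continuousOn
    (hF'.mono hsub)
  have slice : ∀ G : ℝ → X → ℂ, ContinuousOn (fun q : ℝ × X => G q.1 q.2) W →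
      ∀ s ∈ Metric.closedBall (0 : ℝ) ε, ContinuousOn (G s) K := by
    intro G hG s hs
    exact hG.comp (f := fun p : X => (s, p)) (by fun_prop) (fun p hp => hsub ⟨hs, hp⟩)
  have hint : ∀ G : ℝ → X → ℂ, ContinuousOn (fun q : ℝ × X => G q.1 q.2) W →
      ∀ s ∈ Metric.closedBall (0 : ℝ) ε, IntegrableOn (G s) K ν := by
    intro G hG s hs
    obtain ⟨D, hD⟩ := hK.exists_bound_of_continuousOn (slice G hG s hs)
    refine Integrable.of_bound (C := D) ?_ ((ae_restrict_iff' hKm).2 (Eventually.of_forall hD))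
    exact (slice G hG s hs).aestronglyMeasurable_of_isCompact hK hKm
  have h0m := mem_of_mem_nhds hb
  refine ⟨?_, hint F' hF' 0 h0m, ?_⟩
  · filter_upwards [hb] with s hs using hint F hF s hs
  · refine (hasDerivAt_integral_of_dominated_loc_of_deriv_le (bound := fun _ => C) hb ?_
      (hint F hF 0 h0m) (hint F' hF' 0 h0m).1 ?_ (integrable_const _) ?_).2
    · filter_upwards [hb] with s hs using (hint F hF s hs).1
    · refine (ae_restrict_iff' hKm).2 (Eventually.of_forall fun p hp s hs => hC (s, p) ⟨hs, hp⟩)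
    · exact (ae_restrict_iff' hKm).2 (Eventually.of_forall fun p hp s hs =>
        hd s p (hsub ⟨hs, hp⟩))

theorem aux_param_double {E : Type*} [TopologicalSpace E] [MeasurableSpace E] [BorelSpace E]
    [SecondCountableTopology E] [T2Space E]
    [TopologicalSpace.PseudoMetrizableSpace E] {S T : Set E}
    (hS : IsCompact S) (hT : IsCompact T) (μ : Measure E)
    (hSm : μ S < ⊤) (hTm : μ T < ⊤)
    (F F' : ℝ → E × E → ℂ) (W : Set (ℝ × (E × E))) (hW : IsOpen W)
    (hKW : ∀ p ∈ S ×ˢ T, ((0 : ℝ), p) ∈ W)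
    (hF : ContinuousOn (fun q : ℝ × (E × E) => F q.1 q.2) W)
    (hF' : ContinuousOn (fun q : ℝ × (E × E) => F' q.1 q.2) W)
    (hd : ∀ s p, (s, p) ∈ W → HasDerivAt (fun t => F t p) (F' s p) s) :
    HasDerivAt (fun s => ∫ x in S, ∫ y in T, F s (x, y) ∂μ ∂μ)
      (∫ x in S, ∫ y in T, F' 0 (x, y) ∂μ ∂μ) 0 := by
  have : IsFiniteMeasure (μ.restrict S) := ⟨by simpa using hSm⟩
  have : IsFiniteMeasure (μ.restrict T) := ⟨by simpa using hTm⟩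
  obtain ⟨h1, h2, h3⟩ := aux_param (hS.prod hT) (hS.measurableSet.prod hT.measurableSet)
    ((μ.restrict S).prod (μ.restrict T)) F F' W hW hKW hF hF' hd
  have e : ((μ.restrict S).prod (μ.restrict T)).restrict (S ×ˢ T)
      = (μ.restrict S).prod (μ.restrict T) := by
    rw [← Measure.prod_restrict, Measure.restrict_restrict hS.measurableSet,
      Measure.restrict_restrict hT.measurableSet, inter_self, inter_self]
  simp only [IntegrableOn, e] at h1 h2 h3
  rw [integral_prod _ h2] at h3
  refine h3.congr_of_eventuallyEq ?_
  filter_upwards [h1] with s hs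
  rw [integral_prod _ hs]

theorem aux_norm_deriv (k : ℝ) {z : ℝ → EuclideanSpace ℝ (Fin 3)} {z' : EuclideanSpace ℝ (Fin 3)}
    {s : ℝ} (hz : HasDerivAt z z' s) (h0 : z s ≠ 0) :
    HasDerivAt (fun t => helmholtzKernel k (z t))
      (helmholtzKernel k (z s) * (Complex.I * k - 1 / (‖z s‖ : ℂ))
        * (((inner ℝ (z s) z' : ℝ) : ℂ) / (‖z s‖ : ℂ))) s := by
  have hn : ‖z s‖ ≠ 0 := norm_ne_zero_iff.2 h0
  have hr : HasDerivAt (fun t => ‖z t‖) (inner ℝ (z s) z' / ‖z s‖) s := by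
    have := hz.norm_sq.sqrt (pow_ne_zero 2 hn)
    simp only [Real.sqrt_sq (norm_nonneg _)] at this
    convert this using 1
    field_simp
  have hrc := hr.ofReal_comp
  have hnc : (‖z s‖ : ℂ) ≠ 0 := by exact_mod_cast hn
  have hpi : (Real.pi : ℂ) ≠ 0 := by exact_mod_cast Real.pi_ne_zero
  have := (hrc.const_mul (Complex.I * k)).cexp.div (hrc.const_mul (4 * (Real.pi : ℂ)))
    (by simp [hnc, hpi])
  unfold helmholtzKernel
  refine this.congr_deriv ?_
  push_cast
  field_simp

theorem aux_kernel_cont (k : ℝ) : ContinuousOn (helmholtzKernel k) {z | z ≠ 0} := by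
  unfold helmholtzKernel
  refine ContinuousOn.div (by fun_prop) (by fun_prop) ?_
  intro z hz
  have : (‖z‖ : ℂ) ≠ 0 := by exact_mod_cast norm_ne_zero_iff.2 hz
  have hpi : (Real.pi : ℂ) ≠ 0 := by exact_mod_cast Real.pi_ne_zero
  exact mul_ne_zero (mul_ne_zero (by norm_num) hpi) this

/-- shape derivative of the vector-potential term of the EFIE
(formula (diffcurr) of the paper): for disjoint compact sets `T_p, T_q` of finite
two-dimensional Hausdorff measure, continuous `u, v : ℝ³ → ℝ³`, continuous `λ : ℝ³ → ℝ`
and continuous `g : ℝ³ → ℝ³` (playing the role of `∇λ`), the map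
`s ↦ ∫_{T_q} ∫_{T_p} ⟪(I + s·τ⊗g(x))v(x), (I + s·τ⊗g(y))u(y)⟫ g_k(F_s(x) − F_s(y))`
(with `F_s(x) = x + s·λ(x)·τ` and `(τ⊗g)h = ⟪g,h⟫·τ`) is differentiable at `s = 0`,
with the stated derivative. -/
theorem shape_deriv_of_current_integral
    (k : ℝ) (τ : EuclideanSpace ℝ (Fin 3)) (Tp Tq : Set (EuclideanSpace ℝ (Fin 3)))
    (hTp : IsCompact Tp) (hTq : IsCompact Tq) (hdisj : Disjoint Tp Tq)
    (hTpm : μH[2] Tp < ⊤) (hTqm : μH[2] Tq < ⊤)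
    (u v : EuclideanSpace ℝ (Fin 3) → EuclideanSpace ℝ (Fin 3))
    (hu : Continuous u) (hv : Continuous v)
    (lam : EuclideanSpace ℝ (Fin 3) → ℝ) (hlam : Continuous lam)
    (g : EuclideanSpace ℝ (Fin 3) → EuclideanSpace ℝ (Fin 3)) (hg : Continuous g) :
    HasDerivAt
      (fun s : ℝ => ∫ x in Tq, ∫ y in Tp,
        ((inner ℝ (v x + s • ((inner ℝ (g x) (v x) : ℝ) • τ))
                (u y + s • ((inner ℝ (g y) (u y) : ℝ) • τ)) : ℝ) : ℂ)
          * helmholtzKernel k ((x + (s * lam x) • τ) - (y + (s * lam y) • τ)) ∂μH[2] ∂μH[2])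
      (∫ x in Tq, ∫ y in Tp,
        ((((inner ℝ (g x) (v x) : ℝ) * (inner ℝ τ (u y) : ℝ)
            + (inner ℝ τ (v x) : ℝ) * (inner ℝ (g y) (u y) : ℝ) : ℝ) : ℂ)
            * helmholtzKernel k (x - y)
          + ((inner ℝ (v x) (u y) : ℝ) : ℂ) * helmholtzKernel k (x - y)
              * (Complex.I * k - 1 / (‖x - y‖ : ℂ))
              * (((inner ℝ (x - y) τ : ℝ) : ℂ) * ((lam x - lam y : ℝ) : ℂ) / (‖x - y‖ : ℂ)))
        ∂μH[2] ∂μH[2]) 0 := by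

  let Z : ℝ × (EuclideanSpace ℝ (Fin 3) × EuclideanSpace ℝ (Fin 3)) → EuclideanSpace ℝ (Fin 3) :=
    fun q => (q.2.1 + (q.1 * lam q.2.1) • τ) - (q.2.2 + (q.1 * lam q.2.2) • τ)
  let A : ℝ × (EuclideanSpace ℝ (Fin 3) × EuclideanSpace ℝ (Fin 3)) → EuclideanSpace ℝ (Fin 3) :=
    fun q => v q.2.1 + q.1 • ((inner ℝ (g q.2.1) (v q.2.1) : ℝ) • τ)
  let B : ℝ × (EuclideanSpace ℝ (Fin 3) × EuclideanSpace ℝ (Fin 3)) → EuclideanSpace ℝ (Fin 3) :=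
    fun q => u q.2.2 + q.1 • ((inner ℝ (g q.2.2) (u q.2.2) : ℝ) • τ)
  have hZ : Continuous Z := by fun_prop
  have hA : Continuous A := by fun_prop
  have hB : Continuous B := by fun_prop
  have hG : ContinuousOn (fun q => helmholtzKernel k (Z q)) {q | Z q ≠ 0} :=
    (aux_kernel_cont k).comp hZ.continuousOn (fun q hq => hq)
  have hnz : ∀ q ∈ {q | Z q ≠ 0}, (‖Z q‖ : ℂ) ≠ 0 := fun q hq => by
    exact_mod_cast norm_ne_zero_iff.2 hq
  have hN : ContinuousOn (fun q => (‖Z q‖ : ℂ)) {q | Z q ≠ 0} := by fun_prop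
  have key := aux_param_double hTq hTp (μH[2]) hTqm hTpm
    (fun s p => ((inner ℝ (A (s, p)) (B (s, p)) : ℝ) : ℂ) * helmholtzKernel k (Z (s, p)))
    (fun s p => ((inner ℝ (A (s, p)) ((inner ℝ (g p.2) (u p.2) : ℝ) • τ)
        + inner ℝ ((inner ℝ (g p.1) (v p.1) : ℝ) • τ) (B (s, p)) : ℝ) : ℂ)
          * helmholtzKernel k (Z (s, p))
      + ((inner ℝ (A (s, p)) (B (s, p)) : ℝ) : ℂ) * (helmholtzKernel k (Z (s, p))
        * (Complex.I * k - 1 / (‖Z (s, p)‖ : ℂ))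
        * (((inner ℝ (Z (s, p)) ((lam p.1 - lam p.2) • τ) : ℝ) : ℂ) / (‖Z (s, p)‖ : ℂ))))
    {q | Z q ≠ 0} (isOpen_ne_fun hZ continuous_const) ?_ ?_ ?_ ?_
  · refine key.congr_deriv ?_
    congr 1
    ext x
    congr 1
    ext y
    simp only [Z, A, B, zero_mul, zero_smul, add_zero, inner_smul_left, inner_smul_right]
    push_cast
    simp [real_inner_comm]
    ring
  · rintro ⟨x, y⟩ ⟨hx, hy⟩
    simp only [Z, mem_ofPred_eq, zero_mul, zero_smul, add_zero]
    intro h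
    rw [sub_eq_zero] at h
    have h' : x = y := h
    subst h'
    exact disjoint_left.1 hdisj hy hx
  · exact ContinuousOn.mul (by fun_prop) hG
  · refine ContinuousOn.add (ContinuousOn.mul (by fun_prop) hG) (ContinuousOn.mul (by fun_prop)
      (ContinuousOn.mul (ContinuousOn.mul hG (ContinuousOn.sub (by fun_prop)
        (ContinuousOn.div (by fun_prop) hN hnz))) (ContinuousOn.div (by fun_prop) hN hnz)))
  · rintro s ⟨x, y⟩ hs
    have lin : ∀ a b : EuclideanSpace ℝ (Fin 3), HasDerivAt (fun t : ℝ => a + t • b) b s := by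
      intro a b
      simpa using ((hasDerivAt_id s).smul_const b).const_add a
    have dA : HasDerivAt (fun t => A (t, (x, y))) ((inner ℝ (g x) (v x) : ℝ) • τ) s :=
      lin (v x) ((inner ℝ (g x) (v x) : ℝ) • τ)
    have dB : HasDerivAt (fun t => B (t, (x, y))) ((inner ℝ (g y) (u y) : ℝ) • τ) s :=
      lin (u y) ((inner ℝ (g y) (u y) : ℝ) • τ)
    have dZ : HasDerivAt (fun t => Z (t, (x, y))) ((lam x - lam y) • τ) s := by
      have := (lin x (lam x • τ)).sub (lin y (lam y • τ))
      simp only [smul_smul, ← sub_smul] at this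
      exact this
    exact (dA.inner ℝ dB).ofReal_comp.mul (aux_norm_deriv k dZ hs)
end
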